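/- arXiv:2402.07237 — 5 statements merged into one kernel-verified Lean document; each statement's English description precedes it below -/
import Mathlib

section
/- Let λ > 0. Then there exist R > 0 and ε ∈ (0,1) such that there is one and only one function u : [0,R] → ℝ which is continuously differentiable on [0,R], twice differentiable on (0,R), satisfies u(0) = u'(0) = 0, sup_{[0,R]}|u| + sup_{[0,R]}|u'| ≤ ε, and satisfies for all r ∈ (0,R): u''(r)/(1−u'(r)²)^{3/2} + u'(r)/(r·√(1−u'(r)²)) = 2(1/√(1−u'(r)²) − λ). (Existence and uniqueness of the radial spacelike λ-translator intersecting the rotation axis orthogonally.) -/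
open Real Set

/-- `u` (with derivative `u'`) is a radial spacelike λ-translator profile on `[0,R]`
with `u(0) = u'(0) = 0` and C¹-norm at most `ε`. -/
def IsRadialSpacelikeSol (lam R ε : ℝ) (u u' : ℝ → ℝ) : Prop :=
  (∀ r ∈ Icc (0:ℝ) R, HasDerivWithinAt u (u' r) (Icc (0:ℝ) R) r) ∧
  ContinuousOn u' (Icc (0:ℝ) R) ∧
  u 0 = 0 ∧ u' 0 = 0 ∧
  (∀ r ∈ Icc (0:ℝ) R, ∀ s ∈ Icc (0:ℝ) R, |u r| + |u' s| ≤ ε) ∧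
  (∀ r ∈ Ioo (0:ℝ) R, ∃ d2 : ℝ,
    HasDerivAt u' d2 r ∧
    d2 / (1 - u' r ^ 2) ^ ((3:ℝ)/2) + u' r / (r * Real.sqrt (1 - u' r ^ 2)) =
      2 * (1 / Real.sqrt (1 - u' r ^ 2) - lam))
theorem abs_sqrt_one_add_sq_sub_le (a b : ℝ) : |√(1 + a ^ 2) - √(1 + b ^ 2)| ≤ |a - b| := by
  have hA := Real.sqrt_pos.2 (show (0:ℝ) < 1 + a ^ 2 by positivity)
  have hB := Real.sqrt_pos.2 (show (0:ℝ) < 1 + b ^ 2 by positivity)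
  have hA2 := Real.sq_sqrt (show (0:ℝ) ≤ 1 + a ^ 2 by positivity)
  have hB2 := Real.sq_sqrt (show (0:ℝ) ≤ 1 + b ^ 2 by positivity)
  have hab : 1 + a * b ≤ √(1 + a ^ 2) * √(1 + b ^ 2) := by
    rw [← Real.sqrt_mul (by positivity)]
    exact Real.le_sqrt_of_sq_le (by nlinarith [sq_nonneg (a - b)])
  apply sq_le_sq.1
  nlinarith

theorem rpow_three_halves {x : ℝ} (hx : 0 ≤ x) : x ^ ((3:ℝ) / 2) = √x ^ 3 := by
  rw [Real.sqrt_eq_rpow, ← Real.rpow_natCast, ← Real.rpow_mul hx]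
  norm_num

theorem hasDerivAt_div_sqrt_one_add_sq (x : ℝ) :
    HasDerivAt (fun y : ℝ => y / √(1 + y ^ 2)) (1 / √(1 + x ^ 2) ^ 3) x := by
  have h0 : (0:ℝ) < 1 + x ^ 2 := by positivity
  have hs := Real.sqrt_pos.2 h0
  have h2 := Real.sq_sqrt h0.le
  have h1 : HasDerivAt (fun y : ℝ => 1 + y ^ 2) (2 * x) x := by
    simpa using (hasDerivAt_pow 2 x).const_add 1
  refine ((hasDerivAt_id x).div (h1.sqrt h0.ne') hs.ne').congr_deriv ?_
  simp only [id]
  generalize √(1 + x ^ 2) = s at *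
  field_simp
  linarith

theorem hasDerivAt_div_sqrt_one_sub_sq {x : ℝ} (h0 : 0 < 1 - x ^ 2) :
    HasDerivAt (fun y : ℝ => y / √(1 - y ^ 2)) (1 / √(1 - x ^ 2) ^ 3) x := by
  have hs := Real.sqrt_pos.2 h0
  have h2 := Real.sq_sqrt h0.le
  have h1 : HasDerivAt (fun y : ℝ => 1 - y ^ 2) (-(2 * x)) x := by
    simpa using (hasDerivAt_pow 2 x).const_sub 1
  refine ((hasDerivAt_id x).div (h1.sqrt h0.ne') hs.ne').congr_deriv ?_
  simp only [id]
  generalize √(1 - x ^ 2) = s at *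
  field_simp
  linarith

theorem sqrt_one_sub_div_sqrt_sq (w : ℝ) :
    √(1 - (w / √(1 + w ^ 2)) ^ 2) = 1 / √(1 + w ^ 2) := by
  have h0 : (0:ℝ) < 1 + w ^ 2 := by positivity
  rw [div_pow, Real.sq_sqrt h0.le, one_sub_div h0.ne', add_sub_cancel_right,
    Real.sqrt_div zero_le_one, Real.sqrt_one]

theorem sqrt_one_add_div_sqrt_sq {p : ℝ} (h0 : 0 < 1 - p ^ 2) :
    √(1 + (p / √(1 - p ^ 2)) ^ 2) = 1 / √(1 - p ^ 2) := by
  rw [div_pow, Real.sq_sqrt h0.le, one_add_div h0.ne', sub_add_cancel,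
    Real.sqrt_div zero_le_one, Real.sqrt_one]

/-- Uniqueness for the singular first-order equation satisfied by `w = u' / √(1 - u'²)`. -/
theorem eqOn_of_singular_ode {lam R : ℝ} (hR : R ≤ 1 / 4) {w z : ℝ → ℝ}
    (hw : ContinuousOn w (Icc 0 R)) (hz : ContinuousOn z (Icc 0 R)) (h0 : w 0 = z 0)
    (hw' : ∀ r ∈ Ioo 0 R, HasDerivAt w (2 * (√(1 + w r ^ 2) - lam) - w r / r) r)
    (hz' : ∀ r ∈ Ioo 0 R, HasDerivAt z (2 * (√(1 + z r ^ 2) - lam) - z r / r) r) :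
    EqOn w z (Icc 0 R) := by
  rcases lt_or_ge R 0 with hneg | hRnn
  · simp [Icc_eq_empty_of_lt hneg]
  obtain ⟨m, hm, hmax⟩ := isCompact_Icc.exists_isMaxOn (nonempty_Icc.2 hRnn) (hw.sub hz).abs
  have hle : ∀ s ∈ Icc 0 R, |w s - z s| ≤ |w m - z m| := fun s hs => hmax hs
  set M := |w m - z m| with hM
  suffices hM0 : M ≤ 0 by
    intro s hs
    exact sub_eq_zero.1 (abs_nonpos_iff.1 ((hle s hs).trans hM0))
  rcases hm.1.eq_or_lt with hm0 | hm0
  · rw [hM, ← hm0, h0]; simp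
  have hderiv : ∀ s ∈ Ioo 0 m, HasDerivAt (fun t => t * (w t - z t))
      (2 * s * (√(1 + w s ^ 2) - √(1 + z s ^ 2))) s := by
    intro s hs
    have hsR : s ∈ Ioo 0 R := ⟨hs.1, hs.2.trans_le hm.2⟩
    refine ((hasDerivAt_id s).mul ((hw' s hsR).sub (hz' s hsR))).congr_deriv ?_
    have hs0 := hs.1.ne'
    simp only [id, Pi.sub_apply]
    field_simp
    ring
  obtain ⟨c, hc, hslope⟩ := exists_hasDerivAt_eq_slope (fun t => t * (w t - z t)) _ hm0
    (continuousOn_id.mul ((hw.sub hz).mono (Icc_subset_Icc_right hm.2))) hderiv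
  have hD : w m - z m = 2 * c * (√(1 + w c ^ 2) - √(1 + z c ^ 2)) := by
    rw [hslope]
    field_simp
    ring
  have hcM : |√(1 + w c ^ 2) - √(1 + z c ^ 2)| ≤ M :=
    (abs_sqrt_one_add_sq_sub_le _ _).trans (hle c ⟨hc.1.le, hc.2.le.trans hm.2⟩)
  have hMc : M = 2 * c * |√(1 + w c ^ 2) - √(1 + z c ^ 2)| := by
    rw [hM, hD, abs_mul, abs_of_pos (by linarith [hc.1])]
  have hM_nonneg : 0 ≤ M := abs_nonneg _
  have : 2 * c ≤ 1 / 2 := by linarith [hc.2, hm.2]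
  nlinarith [abs_nonneg (√(1 + w c ^ 2) - √(1 + z c ^ 2))]

/-- The averaged right-hand side: `r · translatorOp lam w r = ∫₀ʳ 2s(√(1 + w(s)²) - lam) ds`. -/
noncomputable def translatorOp (lam : ℝ) (w : ℝ → ℝ) (r : ℝ) : ℝ :=
  ∫ t in (0:ℝ)..1, 2 * (r * t) * (√(1 + w (r * t) ^ 2) - lam)

theorem continuous_translatorOp (lam : ℝ) {w : ℝ → ℝ} (hw : Continuous w) :
    Continuous (translatorOp lam w) := by
  unfold translatorOp
  apply intervalIntegral.continuous_parametric_intervalIntegral_of_continuous'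
  fun_prop

theorem mul_translatorOp (lam : ℝ) (w : ℝ → ℝ) (r : ℝ) :
    r * translatorOp lam w r = ∫ s in (0:ℝ)..r, 2 * s * (√(1 + w s ^ 2) - lam) := by
  have := intervalIntegral.mul_integral_comp_mul_left (a := 0) (b := 1)
    (f := fun s => 2 * s * (√(1 + w s ^ 2) - lam)) r
  simpa [translatorOp] using this

theorem abs_translatorOp_sub_le (lam : ℝ) {w z : ℝ → ℝ} (hw : Continuous w) (hz : Continuous z)
    {r d : ℝ} (hr : 0 ≤ r) (hd : ∀ s, |w s - z s| ≤ d) :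
    |translatorOp lam w r - translatorOp lam z r| ≤ 2 * r * d := by
  have hd0 : 0 ≤ d := (abs_nonneg _).trans (hd 0)
  unfold translatorOp
  rw [← intervalIntegral.integral_sub (Continuous.intervalIntegrable (by fun_prop) _ _)
    (Continuous.intervalIntegrable (by fun_prop) _ _)]
  have h := intervalIntegral.norm_integral_le_of_norm_le_const (a := 0) (b := 1) (C := 2 * r * d)
    (f := fun t => 2 * (r * t) * (√(1 + w (r * t) ^ 2) - lam)
      - 2 * (r * t) * (√(1 + z (r * t) ^ 2) - lam)) ?_
  · simpa using h
  · intro t ht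
    rw [uIoc_of_le zero_le_one] at ht
    rw [Real.norm_eq_abs, ← mul_sub, sub_sub_sub_cancel_right, abs_mul,
      abs_of_nonneg (by have := ht.1; positivity)]
    have h2 : 2 * (r * t) ≤ 2 * r := by nlinarith [ht.2]
    exact mul_le_mul h2 ((abs_sqrt_one_add_sq_sub_le _ _).trans (hd _)) (abs_nonneg _)
      (by positivity)

theorem abs_translatorOp_zero_le {lam r : ℝ} (hlam : 0 ≤ lam) (hr : 0 ≤ r) :
    |translatorOp lam (fun _ => 0) r| ≤ r * (1 + lam) := by
  have h : translatorOp lam (fun _ => 0) r = r * (1 - lam) := by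
    have h1 : ∀ t : ℝ, 2 * (r * t) * (√(1 + 0 ^ 2) - lam) = 2 * r * (1 - lam) * t := by
      intro t
      simp only [ne_eq, OfNat.ofNat_ne_zero, not_false_eq_true, zero_pow, add_zero, Real.sqrt_one]
      ring
    rw [translatorOp, intervalIntegral.integral_congr fun t _ => h1 t,
      intervalIntegral.integral_const_mul, integral_id]
    ring
  rw [h, abs_mul, abs_of_nonneg hr]
  exact mul_le_mul_of_nonneg_left (abs_le.2 ⟨by linarith, by linarith⟩) hr

theorem exists_fixedPoint_translatorOp {lam R : ℝ} (hlam : 0 ≤ lam) (hR : 0 ≤ R)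
    (hR4 : R ≤ 1 / 4) :
    ∃ w : ℝ → ℝ, Continuous w ∧ (∀ r ∈ Icc 0 R, translatorOp lam w r = w r) ∧
      ∀ r, |w r| ≤ 2 * R * (1 + lam) := by
  let T : C(Icc (0:ℝ) R, ℝ) → C(Icc (0:ℝ) R, ℝ) := fun w =>
    ⟨fun r => translatorOp lam (IccExtend hR w) r,
      (continuous_translatorOp lam w.continuous.Icc_extend').comp continuous_subtype_val⟩
  have hT : ContractingWith (1 / 2) T := by
    refine ⟨by norm_num, LipschitzWith.of_dist_le_mul fun w z => ?_⟩
    rw [ContinuousMap.dist_le (by positivity)]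
    intro r
    have h := abs_translatorOp_sub_le lam (w.continuous.Icc_extend' (h := hR))
      (z.continuous.Icc_extend' (h := hR)) r.2.1 (d := dist w z) fun s => ContinuousMap.dist_apply_le_dist (f := w) (g := z) _
    refine h.trans (mul_le_mul_of_nonneg_right ?_ dist_nonneg)
    push_cast
    linarith [r.2.2]
  obtain ⟨w, hw⟩ : ∃ w, T w = w := ⟨_, hT.fixedPoint_isFixedPt⟩
  have hfix : ∀ r ∈ Icc 0 R, translatorOp lam (IccExtend hR w) r = IccExtend hR w r := by
    intro r hr
    rw [IccExtend_of_mem hR w hr]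
    exact DFunLike.congr_fun hw ⟨r, hr⟩
  have hbd : ∀ r, |IccExtend hR w r| ≤ ‖w‖ := fun r => w.norm_coe_le_norm _
  have hnorm : ‖w‖ ≤ R * (1 + lam) + 2 * R * ‖w‖ := by
    rw [ContinuousMap.norm_le _ (by positivity)]
    intro r
    have h1 := abs_translatorOp_sub_le lam w.continuous.Icc_extend' continuous_const
      r.2.1 (z := fun _ => 0) (d := ‖w‖) fun s => by simpa using hbd s
    have h2 := abs_translatorOp_zero_le hlam r.2.1
    rw [hfix r r.2, IccExtend_val] at h1
    rw [Real.norm_eq_abs]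
    have h3 := abs_sub_abs_le_abs_sub (w r) (translatorOp lam (fun _ => 0) r)
    have h4 : (r:ℝ) * (1 + lam) ≤ R * (1 + lam) :=
      mul_le_mul_of_nonneg_right r.2.2 (by linarith)
    have h5 : 2 * (r:ℝ) * ‖w‖ ≤ 2 * R * ‖w‖ :=
      mul_le_mul_of_nonneg_right (by linarith [r.2.2]) (norm_nonneg _)
    linarith
  refine ⟨IccExtend hR w, w.continuous.Icc_extend', hfix, fun r => (hbd r).trans ?_⟩
  nlinarith [norm_nonneg w]

theorem hasDerivAt_of_translatorOp_eq {lam R : ℝ} {w : ℝ → ℝ} (hw : Continuous w)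
    (hfix : ∀ r ∈ Icc 0 R, translatorOp lam w r = w r) {r : ℝ} (hr : r ∈ Ioo 0 R) :
    HasDerivAt w (2 * (√(1 + w r ^ 2) - lam) - w r / r) r := by
  have hr0 : r ≠ 0 := hr.1.ne'
  have hg : Continuous fun s => 2 * s * (√(1 + w s ^ 2) - lam) := by fun_prop
  have hd := (intervalIntegral.integral_hasDerivAt_right (hg.intervalIntegrable 0 r)
    (hg.stronglyMeasurableAtFilter _ _) hg.continuousAt).div (hasDerivAt_id r) hr0
  have hval := mul_translatorOp lam w r
  rw [hfix r ⟨hr.1.le, hr.2.le⟩] at hval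
  refine (hd.congr_of_eventuallyEq ?_).congr_deriv ?_
  · filter_upwards [isOpen_Ioo.mem_nhds hr] with s hs
    rw [← hfix s ⟨hs.1.le, hs.2.le⟩, Pi.div_apply, ← mul_translatorOp, id,
      mul_div_cancel_left₀ _ hs.1.ne']
  · rw [← hval]
    simp only [id]
    field_simp

theorem exists_isRadialSpacelikeSol {lam R ε : ℝ} (hlam : 0 ≤ lam) (hR : 0 ≤ R)
    (hR4 : R ≤ 1 / 4) (hε : 4 * R * (1 + lam) ≤ ε) :
    ∃ u u' : ℝ → ℝ, IsRadialSpacelikeSol lam R ε u u' := by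
  obtain ⟨w, hw, hfix, hbd⟩ := exists_fixedPoint_translatorOp hlam hR hR4
  have hpos : ∀ r, 0 < √(1 + w r ^ 2) := fun r => Real.sqrt_pos.2 (by positivity)
  set p : ℝ → ℝ := fun r => w r / √(1 + w r ^ 2) with hp
  have hpc : Continuous p := by
    refine hw.div (by fun_prop) fun r => (hpos r).ne'
  have hpbd : ∀ r, |p r| ≤ 2 * R * (1 + lam) := by
    intro r
    have h1 : 1 ≤ √(1 + w r ^ 2) := Real.one_le_sqrt.2 (by nlinarith [sq_nonneg (w r)])
    rw [hp, abs_div, abs_of_pos (hpos r)]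
    exact (div_le_self (abs_nonneg _) h1).trans (hbd r)
  have hw0 : w 0 = 0 := by
    rw [← hfix 0 ⟨le_rfl, hR⟩]
    simp [translatorOp]
  refine ⟨fun r => ∫ s in (0:ℝ)..r, p s, p, fun r _ => ?_, hpc.continuousOn, by simp,
    by simp [hp, hw0], fun r hr s _ => ?_, fun r hr => ?_⟩
  · exact (intervalIntegral.integral_hasDerivAt_right (hpc.intervalIntegrable 0 r)
      (hpc.stronglyMeasurableAtFilter _ _) hpc.continuousAt).hasDerivWithinAt
  · have h1 := intervalIntegral.norm_integral_le_of_norm_le_const (a := 0) (b := r) (f := p)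
      (C := 2 * R * (1 + lam)) fun t _ => hpbd t
    rw [Real.norm_eq_abs, sub_zero, abs_of_nonneg hr.1] at h1
    have h2 : 2 * R * (1 + lam) * r ≤ 2 * R * (1 + lam) :=
      mul_le_of_le_one_right (by positivity) (by linarith [hr.2])
    linarith [hpbd s]
  · have hd := (hasDerivAt_div_sqrt_one_add_sq (w r)).comp r
      (hasDerivAt_of_translatorOp_eq hw hfix hr)
    refine ⟨_, hd, ?_⟩
    have hsq : √(1 - p r ^ 2) = 1 / √(1 + w r ^ 2) := sqrt_one_sub_div_sqrt_sq (w r)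
    have hnn : 0 < 1 - p r ^ 2 := Real.sqrt_pos.1 (hsq ▸ one_div_pos.2 (hpos r))
    rw [rpow_three_halves hnn.le, hsq]
    simp only [hp]
    have h1 := hpos r
    have h2 := hr.1
    generalize √(1 + w r ^ 2) = q at *
    field_simp
    ring

theorem IsRadialSpacelikeSol.one_sub_sq_pos {lam R ε : ℝ} {u u' : ℝ → ℝ}
    (h : IsRadialSpacelikeSol lam R ε u u') (hε : ε < 1) {r : ℝ} (hr : r ∈ Icc 0 R) :
    0 < 1 - u' r ^ 2 := by
  have h1 := h.2.2.2.2.1 r hr r hr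
  have h2 : |u' r| < 1 := by linarith [abs_nonneg (u r)]
  have := (sq_lt_one_iff_abs_lt_one _).2 h2
  linarith

theorem IsRadialSpacelikeSol.continuousOn_div_sqrt {lam R ε : ℝ} {u u' : ℝ → ℝ}
    (h : IsRadialSpacelikeSol lam R ε u u') (hε : ε < 1) :
    ContinuousOn (fun r => u' r / √(1 - u' r ^ 2)) (Icc 0 R) :=
  h.2.1.div (continuousOn_const.sub (h.2.1.pow 2)).sqrt fun _ hr =>
    (Real.sqrt_pos.2 (h.one_sub_sq_pos hε hr)).ne'

theorem IsRadialSpacelikeSol.hasDerivAt_div_sqrt {lam R ε : ℝ} {u u' : ℝ → ℝ}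
    (h : IsRadialSpacelikeSol lam R ε u u') (hε : ε < 1) {r : ℝ} (hr : r ∈ Ioo 0 R) :
    HasDerivAt (fun r => u' r / √(1 - u' r ^ 2))
      (2 * (√(1 + (u' r / √(1 - u' r ^ 2)) ^ 2) - lam) - u' r / √(1 - u' r ^ 2) / r) r := by
  have h0 := h.one_sub_sq_pos hε (Ioo_subset_Icc_self hr)
  obtain ⟨d, hd, heq⟩ := h.2.2.2.2.2 r hr
  refine ((hasDerivAt_div_sqrt_one_sub_sq h0).comp r hd).congr_deriv ?_
  rw [rpow_three_halves h0.le] at heq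
  rw [sqrt_one_add_div_sqrt_sq h0, ← heq, div_div, mul_comm r]
  ring

theorem IsRadialSpacelikeSol.eqOn {lam R ε : ℝ} (hR4 : R ≤ 1 / 4) (hε : ε < 1)
    {u u' v v' : ℝ → ℝ} (hu : IsRadialSpacelikeSol lam R ε u u')
    (hv : IsRadialSpacelikeSol lam R ε v v') : EqOn u v (Icc 0 R) := by
  have hw := eqOn_of_singular_ode hR4 (hu.continuousOn_div_sqrt hε) (hv.continuousOn_div_sqrt hε)
    (by simp [hu.2.2.2.1, hv.2.2.2.1]) (fun _ => hu.hasDerivAt_div_sqrt hε)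
    (fun _ => hv.hasDerivAt_div_sqrt hε)
  have hderiv : EqOn u' v' (Icc 0 R) := by
    intro r hr
    have hur := hu.one_sub_sq_pos hε hr
    have hvr := hv.one_sub_sq_pos hε hr
    have hwr : u' r / √(1 - u' r ^ 2) = v' r / √(1 - v' r ^ 2) := hw hr
    have hs : √(1 - u' r ^ 2) = √(1 - v' r ^ 2) := by
      have := sqrt_one_add_div_sqrt_sq hur
      rw [hwr, sqrt_one_add_div_sqrt_sq hvr] at this
      simpa using this.symm
    rw [hs] at hwr
    exact (div_left_inj' (Real.sqrt_pos.2 hvr).ne').1 hwr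
  intro r hr
  have h0 : (0:ℝ) ∈ Icc 0 R := ⟨le_rfl, hr.1.trans hr.2⟩
  have h := (convex_Icc (0:ℝ) R).norm_image_sub_le_of_norm_hasDerivWithin_le (C := 0)
    (fun s hs => (hu.1 s hs).sub (hv.1 s hs)) (fun s hs => by simp [hderiv hs]) h0 hr
  simpa [hu.2.2.1, hv.2.2.1, sub_eq_zero] using h

/-- Existence and uniqueness of the radial spacelike λ-translator intersecting
the rotation axis orthogonally. -/
theorem exists_unique_radial_spacelike_translator (lam : ℝ) (hlam : 0 < lam) :
    ∃ R > (0:ℝ), ∃ ε ∈ Ioo (0:ℝ) 1,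
      (∃ u u' : ℝ → ℝ, IsRadialSpacelikeSol lam R ε u u') ∧
      (∀ u u' v v' : ℝ → ℝ, IsRadialSpacelikeSol lam R ε u u' →
        IsRadialSpacelikeSol lam R ε v v' → EqOn u v (Icc (0:ℝ) R)) := by
  have hpos : 0 < 8 * (1 + lam) := by positivity
  have hR4 : 1 / (8 * (1 + lam)) ≤ 1 / 4 :=
    one_div_le_one_div_of_le (by norm_num) (by linarith)
  refine ⟨1 / (8 * (1 + lam)), by positivity, 1 / 2, ⟨by norm_num, by norm_num⟩,
    exists_isRadialSpacelikeSol hlam.le (by positivity) hR4 (le_of_eq ?_),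
    fun u u' v v' hu hv => hu.eqOn hR4 (by norm_num) hv⟩
  field_simp
  norm_num
end

section
/- Let λ > 0, R > 0, and let u : [0,R] → ℝ be continuously differentiable on [0,R] and twice differentiable on (0,R), with u(0) = u'(0) = 0, |u'(r)| < 1 for all r, and satisfying for all r ∈ (0,R): u''(r)/(1−u'(r)²)^{3/2} + u'(r)/(r·√(1−u'(r)²)) = 2(1/√(1−u'(r)²) − λ). If moreover u satisfies the equivalent integral equation u'(r) = g(r)/√(1+g(r)²) with g(r) = (2/r)·∫₀^r s·(1/√(1−u'(s)²) − λ) ds, then lim_{r→0⁺} u'(r)/r = 1−λ and lim_{r→0⁺} u''(r) = 1−λ; in particular u extends with C² regularity to r = 0. -/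
open Real Set Filter

/-- The mean of a continuous function against the density `2 s / r ^ 2` on `[0, r]` tends to its
value at the origin. -/
theorem tendsto_two_div_sq_mul_integral_id_mul {f : ℝ → ℝ} (hf : Continuous f) :
    Tendsto (fun r => (∫ s in (0:ℝ)..r, s * f s) * (2 / r ^ 2)) (nhdsWithin 0 (Ioi 0))
      (nhds (f 0)) := by
  have hc : Continuous fun s => s * f s := by fun_prop
  have hN : ∀ r, HasDerivAt (fun r => ∫ s in (0:ℝ)..r, s * f s) (r * f r) r := fun r =>
    hc.integral_hasStrictDerivAt 0 r |>.hasDerivAt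
  have hD : ∀ r : ℝ, HasDerivAt (fun r : ℝ => r ^ 2 / 2) r r := fun r => by
    simpa using (hasDerivAt_pow 2 r).div_const 2
  have hlim : Tendsto (fun r => r * f r / r) (nhdsWithin 0 (Ioi 0)) (nhds (f 0)) := by
    refine (hf.continuousWithinAt (s := Ioi 0) (x := 0)).tendsto.congr' ?_
    filter_upwards [self_mem_nhdsWithin] with r hr
    have : r ≠ 0 := ne_of_gt hr
    field_simp
  have key := HasDerivAt.lhopital_zero_nhdsGT
    (Eventually.of_forall hN) (Eventually.of_forall hD)
    (by filter_upwards [self_mem_nhdsWithin] with r hr using ne_of_gt hr)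
    (by simpa using ((hN 0).continuousAt.tendsto.mono_left nhdsWithin_le_nhds))
    (by simpa using ((hD 0).continuousAt.tendsto.mono_left nhdsWithin_le_nhds)) hlim
  refine key.congr fun r => ?_
  rw [div_eq_mul_inv, inv_div]

/-- C² regularity of the radial spacelike λ-translator at the axis:
`u'(r)/r → 1 − λ` and `u''(r) → 1 − λ` as `r → 0⁺`. -/
theorem radial_spacelike_translator_C2_at_axis
    (lam R : ℝ) (hlam : 0 < lam) (hR : 0 < R) (u u' u'' : ℝ → ℝ)
    (hu : ∀ r ∈ Icc (0:ℝ) R, HasDerivWithinAt u (u' r) (Icc (0:ℝ) R) r)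
    (hu' : ContinuousOn u' (Icc (0:ℝ) R))
    (hu'' : ∀ r ∈ Ioo (0:ℝ) R, HasDerivAt u' (u'' r) r)
    (h0 : u 0 = 0) (h0' : u' 0 = 0)
    (hlt : ∀ r ∈ Icc (0:ℝ) R, |u' r| < 1)
    (hODE : ∀ r ∈ Ioo (0:ℝ) R,
      u'' r / (1 - u' r ^ 2) ^ ((3:ℝ)/2) + u' r / (r * Real.sqrt (1 - u' r ^ 2)) =
        2 * (1 / Real.sqrt (1 - u' r ^ 2) - lam))
    (hint : ∀ r ∈ Ioo (0:ℝ) R,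
      u' r = ((2 / r) * ∫ s in (0:ℝ)..r, s * (1 / Real.sqrt (1 - u' s ^ 2) - lam)) /
        Real.sqrt (1 + ((2 / r) * ∫ s in (0:ℝ)..r, s * (1 / Real.sqrt (1 - u' s ^ 2) - lam)) ^ 2)) :
    Tendsto (fun r => u' r / r) (nhdsWithin 0 (Ioi 0)) (nhds (1 - lam)) ∧
    Tendsto u'' (nhdsWithin 0 (Ioi 0)) (nhds (1 - lam)) := by
  set f : ℝ → ℝ := fun s => 1 / Real.sqrt (1 - u' s ^ 2) - lam with hf
  set g : ℝ → ℝ := fun r => (2 / r) * ∫ s in (0:ℝ)..r, s * f s with hg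
  have hpos : ∀ r ∈ Icc (0:ℝ) R, 0 < 1 - u' r ^ 2 := fun r hr => by
    have := (sq_lt_one_iff_abs_lt_one (u' r)).2 (hlt r hr)
    linarith
  have hfc : ContinuousOn f (Icc 0 R) :=
    (continuousOn_const.div (continuousOn_const.sub (hu'.pow 2)).sqrt
      fun r hr => (Real.sqrt_pos.2 (hpos r hr)).ne').sub continuousOn_const
  have hmem : ∀ᶠ r in nhdsWithin (0:ℝ) (Ioi 0), r ∈ Ioo (0:ℝ) R := Ioo_mem_nhdsGT hR
  have hid : Tendsto (fun r : ℝ => r) (nhdsWithin 0 (Ioi 0)) (nhds 0) :=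
    tendsto_id.mono_left nhdsWithin_le_nhds
  have hgr : Tendsto (fun r => g r / r) (nhdsWithin 0 (Ioi 0)) (nhds (1 - lam)) := by
    have hext : Continuous (IccExtend hR.le ((Icc 0 R).domRestrict f)) :=
      (continuousOn_iff_continuous_domRestrict.1 hfc).Icc_extend'
    have hext_eq : ∀ s ∈ Icc 0 R, IccExtend hR.le ((Icc 0 R).domRestrict f) s = f s :=
      fun s hs => IccExtend_of_mem _ _ hs
    have hf0 : f 0 = 1 - lam := by simp [hf, h0']
    have h := tendsto_two_div_sq_mul_integral_id_mul hext
    rw [hext_eq 0 ⟨le_rfl, hR.le⟩, hf0] at h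
    refine h.congr' ?_
    filter_upwards [hmem] with r hr
    have hr0 : r ≠ 0 := hr.1.ne'
    have hI : (∫ s in (0:ℝ)..r, s * IccExtend hR.le ((Icc 0 R).domRestrict f) s) =
        ∫ s in (0:ℝ)..r, s * f s :=
      intervalIntegral.integral_congr fun s hs => by
        rw [uIcc_of_le hr.1.le] at hs
        simp only [hext_eq s ⟨hs.1, hs.2.trans hr.2.le⟩]
    rw [hI, hg]
    field_simp
  have hg0 : Tendsto g (nhdsWithin 0 (Ioi 0)) (nhds 0) := by
    have h := hgr.mul hid
    rw [mul_zero] at h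
    refine h.congr' ?_
    filter_upwards [hmem] with r hr using div_mul_cancel₀ _ hr.1.ne'
  have hslope : Tendsto (fun r => u' r / r) (nhdsWithin 0 (Ioi 0)) (nhds (1 - lam)) := by
    have h := hgr.div ((hg0.pow 2).const_add 1).sqrt (by simp)
    simp only [ne_eq, OfNat.ofNat_ne_zero, not_false_eq_true, zero_pow, add_zero, Real.sqrt_one,
      div_one] at h
    refine h.congr' ?_
    filter_upwards [hmem] with r hr
    rw [hint r hr]
    exact div_right_comm _ _ _
  refine ⟨hslope, ?_⟩
  have hu0 : Tendsto u' (nhdsWithin 0 (Ioi 0)) (nhds 0) := by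
    have h := hslope.mul hid
    rw [mul_zero] at h
    refine h.congr' ?_
    filter_upwards [hmem] with r hr using div_mul_cancel₀ _ hr.1.ne'
  have hw : Tendsto (fun r => 1 - u' r ^ 2) (nhdsWithin 0 (Ioi 0)) (nhds 1) := by
    simpa using (hu0.pow 2).const_sub 1
  have hsq : Tendsto (fun r => Real.sqrt (1 - u' r ^ 2)) (nhdsWithin 0 (Ioi 0)) (nhds 1) := by
    simpa using hw.sqrt
  have hrp : Tendsto (fun r => (1 - u' r ^ 2) ^ ((3:ℝ)/2)) (nhdsWithin 0 (Ioi 0)) (nhds 1) := by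
    simpa using hw.rpow_const (p := (3:ℝ)/2) (Or.inl one_ne_zero)
  have hone : Tendsto (fun _ : ℝ => (1:ℝ)) (nhdsWithin 0 (Ioi 0)) (nhds 1) := tendsto_const_nhds
  have h := ((((hone.div hsq one_ne_zero).sub_const lam).const_mul 2).sub
    (hslope.div hsq one_ne_zero)).mul hrp
  have hval : (2 * ((1:ℝ) / 1 - lam) - (1 - lam) / 1) * 1 = 1 - lam := by ring
  rw [hval] at h
  refine h.congr' ?_
  filter_upwards [hmem] with r hr
  have hp : (1 - u' r ^ 2) ^ ((3:ℝ)/2) ≠ 0 :=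
    (Real.rpow_pos_of_pos (hpos r ⟨hr.1.le, hr.2.le⟩) _).ne'
  simp only [Pi.div_apply]
  rw [← hODE r hr, div_div, add_sub_cancel_right, div_mul_cancel₀ _ hp]
end

section
/- Let λ > 0, set φ(y) = 1/√(1−y²) − λ and f⁻¹(y) = y/√(1+y²). Then there exist ε ∈ (0,1/2) and R > 0 such that, on the set X = { u ∈ C¹([0,R]) : sup_{[0,R]}|u| + sup_{[0,R]}|u'| ≤ ε } equipped with the norm ‖u‖ = sup|u| + sup|u'|, the operator (T u)(r) = ∫₀^r f⁻¹( (2/t)·∫₀^t s·φ(u'(s)) ds ) dt (inner expression understood as 0 at t = 0) maps X into X and is a contraction: there is K ∈ (0,1) with ‖Tu − Tv‖ ≤ K·‖u − v‖ for all u, v ∈ X. Consequently T has a unique fixed point in X. -/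
open Real Set

noncomputable def phiTrans (lam y : ℝ) : ℝ := 1 / Real.sqrt (1 - y ^ 2) - lam

noncomputable def fInv (y : ℝ) : ℝ := y / Real.sqrt (1 + y ^ 2)

/-- The operator `T`: `(T u)(r) = ∫₀^r f⁻¹((2/t) ∫₀^t s φ(u'(s)) ds) dt`, expressed in
terms of the derivative `u'` of `u` (the inner expression is `0` at `t = 0`). -/
noncomputable def Tmap (lam : ℝ) (u' : ℝ → ℝ) : ℝ → ℝ :=
  fun r => ∫ t in (0:ℝ)..r, fInv ((2 / t) * ∫ s in (0:ℝ)..t, s * phiTrans lam (u' s))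

/-- The derivative of `T u`. -/
noncomputable def Tmap' (lam : ℝ) (u' : ℝ → ℝ) : ℝ → ℝ :=
  fun r => fInv ((2 / r) * ∫ s in (0:ℝ)..r, s * phiTrans lam (u' s))

/-- Membership of the pair `(u, u')` in the closed ball
`X = {u ∈ C¹([0,R]) : sup|u| + sup|u'| ≤ ε}`. -/
def MemX (R ε : ℝ) (u u' : ℝ → ℝ) : Prop :=
  (∀ r ∈ Icc (0:ℝ) R, HasDerivWithinAt u (u' r) (Icc (0:ℝ) R) r) ∧
  ContinuousOn u' (Icc (0:ℝ) R) ∧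
  (∀ r ∈ Icc (0:ℝ) R, ∀ s ∈ Icc (0:ℝ) R, |u r| + |u' s| ≤ ε)

lemma abs_fInv_sub_le (x y : ℝ) : |fInv x - fInv y| ≤ |x - y| := by
  have h_arctan : |arctan x - arctan y| ≤ |x - y| := by
    have h := Convex.norm_image_sub_le_of_norm_hasDerivWithin_le (f := arctan)
      (f' := fun z => 1 / (1 + z ^ 2)) (C := 1) (s := univ) (x := y) (y := x)
      (fun z _ => (hasDerivAt_arctan z).hasDerivWithinAt)
      (fun z _ => by
        rw [Real.norm_of_nonneg (by positivity), div_le_one (by positivity)]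
        nlinarith [sq_nonneg z]) convex_univ (mem_univ _) (mem_univ _)
    simpa using h
  have h_sin : |sin (arctan x) - sin (arctan y)| ≤ |arctan x - arctan y| := by
    have h := Convex.norm_image_sub_le_of_norm_hasDerivWithin_le (f := sin)
      (f' := cos) (C := 1) (s := univ) (x := arctan y) (y := arctan x)
      (fun z _ => (hasDerivAt_sin z).hasDerivWithinAt)
      (fun z _ => abs_cos_le_one z) convex_univ (mem_univ _) (mem_univ _)
    simpa using h
  rw [sin_arctan, sin_arctan] at h_sin
  exact h_sin.trans h_arctan

lemma abs_fInv_le (x : ℝ) : |fInv x| ≤ |x| := by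
  simpa [fInv] using abs_fInv_sub_le x 0

lemma continuous_fInv : Continuous fInv := by
  unfold fInv
  exact continuous_id.div (by fun_prop) fun x => by positivity

lemma four_fifths_le_sqrt_one_sub_sq {y : ℝ} (hy : |y| ≤ 1 / 2) : 4 / 5 ≤ √(1 - y ^ 2) := by
  apply Real.le_sqrt_of_sq_le
  have h := abs_le.1 hy
  nlinarith [h.1, h.2]

lemma abs_phiTrans_sub_le (lam : ℝ) {x y : ℝ} (hx : |x| ≤ 1 / 2) (hy : |y| ≤ 1 / 2) :
    |phiTrans lam x - phiTrans lam y| ≤ |x - y| := by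
  have ha := four_fifths_le_sqrt_one_sub_sq hx
  have hb := four_fifths_le_sqrt_one_sub_sq hy
  have hx' := abs_le.1 hx
  have hy' := abs_le.1 hy
  have ha2 : √(1 - x ^ 2) ^ 2 = 1 - x ^ 2 := Real.sq_sqrt (by nlinarith [hx'.1, hx'.2])
  have hb2 : √(1 - y ^ 2) ^ 2 = 1 - y ^ 2 := Real.sq_sqrt (by nlinarith [hy'.1, hy'.2])
  unfold phiTrans
  generalize √(1 - x ^ 2) = a at *
  generalize √(1 - y ^ 2) = b at *
  have hab : 16 / 25 ≤ a * b := by nlinarith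
  have hden : 1 ≤ a * b * (a + b) := by nlinarith
  have key : 1 / a - lam - (1 / b - lam) = (x + y) / (a * b * (a + b)) * (x - y) := by
    have : a ≠ 0 := by linarith
    have : b ≠ 0 := by linarith
    have : a + b ≠ 0 := by linarith
    field_simp
    linear_combination hb2 - ha2
  rw [key, abs_mul, abs_div, abs_of_pos (by linarith : 0 < a * b * (a + b))]
  apply mul_le_of_le_one_left (abs_nonneg _)
  rw [div_le_one (by linarith)]
  exact (abs_le.2 ⟨by linarith [hx'.1, hy'.1], by linarith [hx'.2, hy'.2]⟩).trans hden

lemma abs_phiTrans_le {lam y : ℝ} (hlam : 0 < lam) (hy : |y| ≤ 1 / 2) :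
    |phiTrans lam y| ≤ 2 + lam := by
  have ha := four_fifths_le_sqrt_one_sub_sq hy
  unfold phiTrans
  have h1 : 0 < 1 / √(1 - y ^ 2) := by positivity
  have h2 : 1 / √(1 - y ^ 2) ≤ 2 := by
    rw [div_le_iff₀ (by linarith)]; linarith
  rw [abs_le]
  constructor <;> linarith

lemma continuousOn_phiTrans_comp (lam : ℝ) {w : ℝ → ℝ} {s : Set ℝ} (hw : ContinuousOn w s)
    (hb : ∀ x ∈ s, |w x| ≤ 1 / 2) : ContinuousOn (fun x => phiTrans lam (w x)) s := by
  unfold phiTrans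
  refine (continuousOn_const.div (continuousOn_const.sub (hw.pow 2)).sqrt fun x hx => ?_).sub
    continuousOn_const
  have h : 0 < √(1 - w x ^ 2) := by linarith [four_fifths_le_sqrt_one_sub_sq (hb x hx)]
  exact h.ne'

lemma abs_two_div_mul_integral_le {g : ℝ → ℝ} {t C : ℝ} (ht : 0 ≤ t)
    (hg : ∀ s ∈ Icc 0 t, |g s| ≤ C) : |2 / t * ∫ s in (0:ℝ)..t, s * g s| ≤ C * t := by
  rcases ht.eq_or_lt with rfl | ht'
  · simp
  have h : ‖∫ s in (0:ℝ)..t, s * g s‖ ≤ ∫ s in (0:ℝ)..t, s * C := by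
    refine intervalIntegral.norm_integral_le_of_norm_le ht (.of_forall fun s hs => ?_)
      (Continuous.intervalIntegrable (by fun_prop) _ _)
    rw [norm_mul, Real.norm_of_nonneg hs.1.le]
    exact mul_le_mul_of_nonneg_left (hg s (Ioc_subset_Icc_self hs)) hs.1.le
  rw [intervalIntegral.integral_mul_const, integral_id, Real.norm_eq_abs] at h
  rw [abs_mul, abs_of_pos (by positivity)]
  calc 2 / t * _ ≤ 2 / t * ((t ^ 2 - 0 ^ 2) / 2 * C) := by gcongr
    _ = C * t := by field_simp; ring

section Bounds

variable {lam R : ℝ} {w z : ℝ → ℝ}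

lemma intervalIntegrable_mul_phiTrans (hw : ContinuousOn w (Icc 0 R))
    (hb : ∀ r ∈ Icc 0 R, |w r| ≤ 1 / 2) {t : ℝ} (ht : t ∈ Icc 0 R) :
    IntervalIntegrable (fun s => s * phiTrans lam (w s)) MeasureTheory.volume 0 t := by
  refine ContinuousOn.intervalIntegrable_of_Icc ht.1 ?_
  exact (continuousOn_id.mul (continuousOn_phiTrans_comp lam hw hb)).mono
    (Icc_subset_Icc_right ht.2)

lemma abs_Tmap'_le (hlam : 0 < lam) (hb : ∀ r ∈ Icc 0 R, |w r| ≤ 1 / 2) {r : ℝ}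
    (hr : r ∈ Icc 0 R) : |Tmap' lam w r| ≤ (2 + lam) * r :=
  (abs_fInv_le _).trans <| abs_two_div_mul_integral_le hr.1 fun s hs =>
    abs_phiTrans_le hlam (hb s ⟨hs.1, hs.2.trans hr.2⟩)

lemma abs_Tmap'_sub_le (hw : ContinuousOn w (Icc 0 R)) (hb : ∀ r ∈ Icc 0 R, |w r| ≤ 1 / 2)
    (hz : ContinuousOn z (Icc 0 R)) (hc : ∀ r ∈ Icc 0 R, |z r| ≤ 1 / 2) {B : ℝ}
    (hB : ∀ r ∈ Icc 0 R, |w r - z r| ≤ B) {r : ℝ} (hr : r ∈ Icc 0 R) :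
    |Tmap' lam w r - Tmap' lam z r| ≤ B * r := by
  refine (abs_fInv_sub_le _ _).trans ?_
  rw [← mul_sub, ← intervalIntegral.integral_sub (intervalIntegrable_mul_phiTrans hw hb hr)
    (intervalIntegrable_mul_phiTrans hz hc hr)]
  simp only [← mul_sub]
  refine abs_two_div_mul_integral_le hr.1 fun s hs => ?_
  have hs' : s ∈ Icc 0 R := ⟨hs.1, hs.2.trans hr.2⟩
  exact (abs_phiTrans_sub_le lam (hb s hs') (hc s hs')).trans (hB s hs')

lemma continuousOn_Tmap' (hlam : 0 < lam) (hw : ContinuousOn w (Icc 0 R))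
    (hb : ∀ r ∈ Icc 0 R, |w r| ≤ 1 / 2) : ContinuousOn (Tmap' lam w) (Icc 0 R) := by
  intro r hr
  rcases hr.1.eq_or_lt with rfl | hr'
  · have h0 : Tmap' lam w 0 = 0 := by simp [Tmap', fInv]
    rw [ContinuousWithinAt, h0]
    refine squeeze_zero_norm' (a := fun r => (2 + lam) * r) ?_ ?_
    · filter_upwards [self_mem_nhdsWithin] with s hs using abs_Tmap'_le hlam hb hs
    · have h : Continuous fun r : ℝ => (2 + lam) * r := by fun_prop
      simpa using (h.tendsto 0).mono_left nhdsWithin_le_nhds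
  · have hR : 0 ≤ R := hr.1.trans hr.2
    have hint := intervalIntegral.continuousOn_primitive_interval'
      (intervalIntegrable_mul_phiTrans (lam := lam) hw hb (right_mem_Icc.2 hR)) left_mem_uIcc
    rw [uIcc_of_le hR] at hint
    exact continuous_fInv.continuousAt.comp_continuousWithinAt
      (((continuousAt_const.div continuousAt_id hr'.ne').continuousWithinAt).mul (hint r hr))

lemma abs_integral_le_mul_sq {f : ℝ → ℝ} {C r : ℝ} (hC : 0 ≤ C) (hr : r ∈ Icc 0 R)
    (hf : ∀ t ∈ Icc 0 R, |f t| ≤ C * t) : |∫ t in (0:ℝ)..r, f t| ≤ C * R ^ 2 := by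
  have h := intervalIntegral.norm_integral_le_of_norm_le_const (f := f) (a := 0) (b := r)
    (C := C * R) fun t ht => by
      rw [uIoc_of_le hr.1] at ht
      have htR := ht.2.trans hr.2
      exact (hf t ⟨ht.1.le, htR⟩).trans (by gcongr)
  rw [Real.norm_eq_abs, sub_zero, abs_of_nonneg hr.1] at h
  have hR : 0 ≤ R := hr.1.trans hr.2
  calc _ ≤ C * R * r := h
    _ ≤ C * R * R := by gcongr; exact hr.2
    _ = C * R ^ 2 := by ring

lemma abs_Tmap_sub_le (hlam : 0 < lam) (hw : ContinuousOn w (Icc 0 R))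
    (hb : ∀ r ∈ Icc 0 R, |w r| ≤ 1 / 2) (hz : ContinuousOn z (Icc 0 R))
    (hc : ∀ r ∈ Icc 0 R, |z r| ≤ 1 / 2) {B : ℝ} (hB : ∀ r ∈ Icc 0 R, |w r - z r| ≤ B) {r : ℝ}
    (hr : r ∈ Icc 0 R) : |Tmap lam w r - Tmap lam z r| ≤ B * R ^ 2 := by
  have hint {f : ℝ → ℝ} (hf : ContinuousOn f (Icc 0 R)) :
      IntervalIntegrable f MeasureTheory.volume 0 r :=
    ContinuousOn.intervalIntegrable_of_Icc hr.1 (hf.mono (Icc_subset_Icc_right hr.2))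
  have h : Tmap lam w r - Tmap lam z r = ∫ t in (0:ℝ)..r, (Tmap' lam w t - Tmap' lam z t) :=
    (intervalIntegral.integral_sub (hint (continuousOn_Tmap' hlam hw hb))
      (hint (continuousOn_Tmap' hlam hz hc))).symm
  rw [h]
  exact abs_integral_le_mul_sq ((abs_nonneg _).trans (hB r hr)) hr fun t ht =>
    abs_Tmap'_sub_le hw hb hz hc hB ht

lemma hasDerivWithinAt_Tmap (hlam : 0 < lam) (hw : ContinuousOn w (Icc 0 R))
    (hb : ∀ r ∈ Icc 0 R, |w r| ≤ 1 / 2) {r : ℝ} (hr : r ∈ Icc 0 R) :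
    HasDerivWithinAt (Tmap lam w) (Tmap' lam w r) (Icc 0 R) r := by
  have hR : 0 ≤ R := hr.1.trans hr.2
  set g : ℝ → ℝ := IccExtend hR ((Icc 0 R).domRestrict (Tmap' lam w)) with hg
  have hgc : Continuous g := (continuousOn_Tmap' hlam hw hb).domRestrict.Icc_extend'
  have hgeq : ∀ t ∈ Icc 0 R, g t = Tmap' lam w t := fun t ht => by
    rw [hg, IccExtend_of_mem hR _ ht, domRestrict_apply]
  have hT : ∀ s ∈ Icc 0 R, Tmap lam w s = ∫ t in (0:ℝ)..s, g t := fun s hs =>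
    intervalIntegral.integral_congr fun t ht => by
      rw [uIcc_of_le hs.1] at ht
      exact (hgeq t ⟨ht.1, ht.2.trans hs.2⟩).symm
  rw [← hgeq r hr]
  exact (hgc.integral_hasStrictDerivAt 0 r).hasDerivAt.hasDerivWithinAt.congr hT (hT r hr)

lemma memX_Tmap (hlam : 0 < lam) {ε : ℝ} (hε : (2 + lam) * (R + R ^ 2) ≤ ε)
    (hw : ContinuousOn w (Icc 0 R)) (hb : ∀ r ∈ Icc 0 R, |w r| ≤ 1 / 2) :
    MemX R ε (Tmap lam w) (Tmap' lam w) := by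
  refine ⟨fun r hr => hasDerivWithinAt_Tmap hlam hw hb hr, continuousOn_Tmap' hlam hw hb,
    fun r hr s hs => ?_⟩
  have h1 : |Tmap lam w r| ≤ (2 + lam) * R ^ 2 :=
    abs_integral_le_mul_sq (by positivity) hr fun t ht => abs_Tmap'_le hlam hb ht
  have h2 : |Tmap' lam w s| ≤ (2 + lam) * R :=
    (abs_Tmap'_le hlam hb hs).trans (by gcongr; exact hs.2)
  linarith

lemma Tmap_congr (h : EqOn w z (Icc 0 R)) : EqOn (Tmap lam w) (Tmap lam z) (Icc 0 R) := by
  intro r hr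
  refine intervalIntegral.integral_congr fun t ht => ?_
  rw [uIcc_of_le hr.1] at ht
  have : ∫ s in (0:ℝ)..t, s * phiTrans lam (w s) = ∫ s in (0:ℝ)..t, s * phiTrans lam (z s) := by
    refine intervalIntegral.integral_congr fun s hs => ?_
    rw [uIcc_of_le ht.1] at hs
    simp only [h ⟨hs.1, hs.2.trans (ht.2.trans hr.2)⟩]
  simp only [this]

lemma exists_unique_eqOn_Tmap' (hlam : 0 < lam) (hR : 0 ≤ R) (hR' : R ≤ 1 / 2)
    (hM : (2 + lam) * R ≤ 1 / 2) :
    ∃ w : ℝ → ℝ, ContinuousOn w (Icc 0 R) ∧ (∀ r ∈ Icc 0 R, |w r| ≤ 1 / 2) ∧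
      EqOn (Tmap' lam w) w (Icc 0 R) ∧
      ∀ z : ℝ → ℝ, ContinuousOn z (Icc 0 R) → (∀ r ∈ Icc 0 R, |z r| ≤ 1 / 2) →
        EqOn (Tmap' lam z) z (Icc 0 R) → EqOn z w (Icc 0 R) := by
  let X := Metric.closedBall (0 : C(Icc (0:ℝ) R, ℝ)) (1 / 2)
  have mem_X {f : C(Icc (0:ℝ) R, ℝ)} : f ∈ X ↔ ∀ r, |f r| ≤ 1 / 2 := by
    rw [mem_closedBall_zero_iff, ContinuousMap.norm_le _ (by norm_num)]
    rfl
  let E (f : X) : ℝ → ℝ := IccExtend hR f.1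
  have E_eq (f : X) {r : ℝ} (hr : r ∈ Icc 0 R) : E f r = f.1 ⟨r, hr⟩ := IccExtend_of_mem hR _ hr
  have hEc (f : X) : ContinuousOn (E f) (Icc 0 R) := f.1.continuous.Icc_extend'.continuousOn
  have hEb (f : X) : ∀ r ∈ Icc 0 R, |E f r| ≤ 1 / 2 := fun r hr => by
    rw [E_eq f hr]; exact mem_X.1 f.2 _
  let S (f : X) : X := ⟨⟨(Icc 0 R).domRestrict (Tmap' lam (E f)),
    (continuousOn_Tmap' hlam (hEc f) (hEb f)).domRestrict⟩, mem_X.2 fun r =>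
      (abs_Tmap'_le hlam (hEb f) r.2).trans (le_trans (by gcongr; exact r.2.2) hM)⟩
  have hS : ContractingWith (1 / 2) S := by
    refine ⟨by rw [← NNReal.coe_lt_coe]; norm_num, LipschitzWith.of_dist_le_mul fun f g => ?_⟩
    rw [Subtype.dist_eq, ContinuousMap.dist_le (by positivity)]
    intro r
    have h := abs_Tmap'_sub_le (lam := lam) (hEc f) (hEb f) (hEc g) (hEb g)
      (B := dist f.1 g.1) (fun s hs => by
        rw [E_eq f hs, E_eq g hs]; exact ContinuousMap.dist_apply_le_dist (f := f.1) (g := g.1) _) r.2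
    refine h.trans ?_
    have hr := r.2.2.trans hR'
    have := mul_le_mul_of_nonneg_left hr (dist_nonneg (x := f.1) (y := g.1))
    push_cast
    rw [Subtype.dist_eq]
    linarith
  have : CompleteSpace X := Metric.isClosed_closedBall.completeSpace_coe
  have : Nonempty X := ⟨⟨0, Metric.mem_closedBall_self (by norm_num)⟩⟩
  have hfix : S (hS.fixedPoint S) = hS.fixedPoint S := hS.fixedPoint_isFixedPt
  refine ⟨E (hS.fixedPoint S), hEc _, hEb _, fun r hr => ?_, fun z hz hc hzfix r hr => ?_⟩
  · rw [E_eq _ hr]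
    exact congrArg (fun f : X => f.1 ⟨r, hr⟩) hfix
  · let f : X := ⟨⟨(Icc 0 R).domRestrict z, hz.domRestrict⟩, mem_X.2 fun r => hc r r.2⟩
    have hEz : ∀ s ∈ Icc 0 R, |E f s - z s| ≤ 0 := fun s hs => by
      rw [E_eq f hs, abs_nonpos_iff]; exact sub_self (z s)
    have hf : S f = f := by
      ext s
      have h := abs_Tmap'_sub_le (lam := lam) (hEc f) (hEb f) hz hc hEz s.2
      rw [zero_mul, abs_nonpos_iff, sub_eq_zero] at h
      exact h.trans (hzfix s.2)
    rw [E_eq _ hr, ← hS.fixedPoint_unique hf]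
    rfl

end Bounds

lemma MemX.abs_deriv_le {R ε : ℝ} {u u' : ℝ → ℝ} (h : MemX R ε u u') {r : ℝ}
    (hr : r ∈ Icc 0 R) : |u' r| ≤ ε := by
  linarith [h.2.2 r hr r hr, abs_nonneg (u r)]

/-- For suitable `ε ∈ (0,1/2)` and `R > 0`, the operator `T` is a self-map of `X` and a
contraction for the C¹ norm `‖u‖ = sup|u| + sup|u'|`; consequently it has a unique fixed
point in `X`. -/
theorem Tmap_contraction (lam : ℝ) (hlam : 0 < lam) :
    ∃ ε ∈ Ioo (0:ℝ) (1/2), ∃ R > (0:ℝ),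
      (∀ u u' : ℝ → ℝ, MemX R ε u u' → MemX R ε (Tmap lam u') (Tmap' lam u')) ∧
      (∃ K ∈ Ioo (0:ℝ) 1, ∀ u u' v v' : ℝ → ℝ, MemX R ε u u' → MemX R ε v v' →
        ∀ B : ℝ, (∀ r ∈ Icc (0:ℝ) R, ∀ s ∈ Icc (0:ℝ) R, |u r - v r| + |u' s - v' s| ≤ B) →
          ∀ r ∈ Icc (0:ℝ) R, ∀ s ∈ Icc (0:ℝ) R,
            |Tmap lam u' r - Tmap lam v' r| + |Tmap' lam u' s - Tmap' lam v' s| ≤ K * B) ∧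
      (∃ u u' : ℝ → ℝ, MemX R ε u u' ∧ EqOn (Tmap lam u') u (Icc (0:ℝ) R) ∧
        ∀ v v' : ℝ → ℝ, MemX R ε v v' → EqOn (Tmap lam v') v (Icc (0:ℝ) R) →
          EqOn v u (Icc (0:ℝ) R)) := by
  have hM : 0 < 2 + lam := by linarith
  obtain ⟨R, hR, hMR⟩ : ∃ R > 0, (2 + lam) * R = 1 / 8 :=
    ⟨1 / 8 / (2 + lam), by positivity, by field_simp⟩
  have hR' : R ≤ 1 / 16 := by nlinarith
  have hε : (2 + lam) * (R + R ^ 2) ≤ 1 / 4 := by nlinarith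
  have hbd {u u' : ℝ → ℝ} (h : MemX R (1 / 4) u u') : ∀ r ∈ Icc 0 R, |u' r| ≤ 1 / 2 :=
    fun r hr => (h.abs_deriv_le hr).trans (by norm_num)
  refine ⟨1 / 4, by norm_num, R, hR, fun u u' h => memX_Tmap hlam hε h.2.1 (hbd h),
    ⟨1 / 2, by norm_num, fun u u' v v' hu hv B hB r hr s hs => ?_⟩, ?_⟩
  · have hB' : ∀ t ∈ Icc 0 R, |u' t - v' t| ≤ B := fun t ht => by
      linarith [hB t ht t ht, abs_nonneg (u t - v t)]
    have hB0 : 0 ≤ B := (abs_nonneg _).trans (hB' r hr)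
    have h1 := abs_Tmap_sub_le hlam hu.2.1 (hbd hu) hv.2.1 (hbd hv) hB' hr
    have h2 := abs_Tmap'_sub_le (lam := lam) hu.2.1 (hbd hu) hv.2.1 (hbd hv) hB' hs
    have h3 : R ^ 2 + s ≤ 1 / 2 := by nlinarith [hs.2]
    nlinarith
  · obtain ⟨w, hw, hb, hfix, huniq⟩ :=
      exists_unique_eqOn_Tmap' hlam hR.le (by linarith) (by linarith)
    refine ⟨Tmap lam w, Tmap' lam w, memX_Tmap hlam hε hw hb, Tmap_congr hfix,
      fun v v' hv hvfix => ?_⟩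
    have hv' : EqOn (Tmap' lam v') v' (Icc 0 R) := fun r hr =>
      (uniqueDiffOn_Icc hR r hr).eq_deriv _ (hasDerivWithinAt_Tmap hlam hv.2.1 (hbd hv) hr)
        ((hv.1 r hr).congr hvfix (hvfix hr))
    exact hvfix.symm.trans (Tmap_congr (huniq v' hv.2.1 (hbd hv) hv'))
end

section
/- Let λ = v₃ > 0. For s > 1/(2v₃), define θ(s) = −log( (2v₃s+1)/(2v₃s−1) ), x(s) = s − (1/(2v₃))·log( (2v₃s+1)/(2v₃s−1) ), z(s) = −(1/(2v₃))·log( 4v₃²s² − 1 ). Then for all s > 1/(2v₃): θ'(s) = 2v₃·(cosh θ(s) − 1) = 2(v₃·cosh θ(s) − λ), x'(s) = cosh θ(s), and z'(s) = sinh θ(s); in particular x'(s)² − z'(s)² = 1. -/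
open Real Set

theorem cosh_neg_log_div {u : ℝ} (hu : 1 < u) :
    Real.cosh (-Real.log ((u + 1) / (u - 1))) = (u ^ 2 + 1) / (u ^ 2 - 1) := by
  have h₁ : 0 < u - 1 := by linarith
  have h₂ : 0 < u + 1 := by linarith
  have h₃ : u ^ 2 - 1 ≠ 0 := by nlinarith
  rw [Real.cosh_neg, Real.cosh_log (div_pos h₂ h₁)]
  field_simp
  ring

theorem sinh_neg_log_div {u : ℝ} (hu : 1 < u) :
    Real.sinh (-Real.log ((u + 1) / (u - 1))) = -(2 * u) / (u ^ 2 - 1) := by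
  have h₁ : 0 < u - 1 := by linarith
  have h₂ : 0 < u + 1 := by linarith
  have h₃ : u ^ 2 - 1 ≠ 0 := by nlinarith
  rw [Real.sinh_neg, Real.sinh_log (div_pos h₂ h₁)]
  field_simp
  ring

theorem hasDerivAt_log_div {c s : ℝ} (hu : 1 < c * s) :
    HasDerivAt (fun t => Real.log ((c * t + 1) / (c * t - 1)))
      (-(2 * c) / ((c * s) ^ 2 - 1)) s := by
  have h₁ : c * s - 1 ≠ 0 := by linarith
  have h₂ : c * s + 1 ≠ 0 := by linarith
  have h₃ : c ^ 2 * s ^ 2 - 1 ≠ 0 := by nlinarith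
  have hc : HasDerivAt (fun t => c * t) c s := by
    simpa using (hasDerivAt_id s).const_mul c
  refine (((hc.add_const 1).fun_div (hc.sub_const 1) h₁).log (div_ne_zero h₂ h₁)).congr_deriv ?_
  field_simp
  ring

/-- The case `λ = v₃` of the classification of spacelike cylindrical λ-translators
along a spacelike direction. -/
theorem cylindrical_spacelike_lambda_eq
    (lam v₃ : ℝ) (hv₃ : 0 < v₃) (hlam : lam = v₃)
    (θ x z : ℝ → ℝ)
    (hθ : θ = fun s => -Real.log ((2 * v₃ * s + 1) / (2 * v₃ * s - 1)))
    (hx : x = fun s => s - (1 / (2 * v₃)) * Real.log ((2 * v₃ * s + 1) / (2 * v₃ * s - 1)))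
    (hz : z = fun s => -(1 / (2 * v₃)) * Real.log (4 * v₃ ^ 2 * s ^ 2 - 1)) :
    ∀ s : ℝ, 1 / (2 * v₃) < s →
      HasDerivAt θ (2 * v₃ * (Real.cosh (θ s) - 1)) s ∧
      2 * v₃ * (Real.cosh (θ s) - 1) = 2 * (v₃ * Real.cosh (θ s) - lam) ∧
      HasDerivAt x (Real.cosh (θ s)) s ∧
      HasDerivAt z (Real.sinh (θ s)) s ∧
      Real.cosh (θ s) ^ 2 - Real.sinh (θ s) ^ 2 = 1 := by
  intro s hs
  have hu : 1 < 2 * v₃ * s := by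
    rw [div_lt_iff₀ (by positivity)] at hs
    linarith
  have hv : v₃ ≠ 0 := hv₃.ne'
  have hne : 2 ^ 2 * v₃ ^ 2 * s ^ 2 - 1 ≠ 0 := by nlinarith
  have hθs : θ s = -Real.log ((2 * v₃ * s + 1) / (2 * v₃ * s - 1)) := by rw [hθ]
  have hcosh := cosh_neg_log_div hu
  have hsinh := sinh_neg_log_div hu
  have hlog := hasDerivAt_log_div hu
  rw [← hθs] at hcosh hsinh
  refine ⟨?_, by rw [hlam]; ring, ?_, ?_, Real.cosh_sq_sub_sinh_sq _⟩
  · rw [hcosh, hθ]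
    refine hlog.fun_neg.congr_deriv ?_
    field_simp
    ring
  · rw [hcosh, hx]
    refine ((hasDerivAt_id' s).fun_sub (hlog.const_mul _)).congr_deriv ?_
    field_simp
    ring
  · have hq : HasDerivAt (fun t : ℝ => 4 * v₃ ^ 2 * t ^ 2 - 1) (8 * v₃ ^ 2 * s) s :=
      (((hasDerivAt_pow 2 s).const_mul (4 * v₃ ^ 2)).sub_const 1).congr_deriv (by norm_num; ring)
    have hqs : 4 * v₃ ^ 2 * s ^ 2 - 1 = (2 * v₃ * s) ^ 2 - 1 := by ring
    rw [hsinh, hz]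
    refine ((hq.log (by convert hne using 3; norm_num)).const_mul _).congr_deriv ?_
    rw [hqs]
    field_simp
    ring
end

section
/- Let 0 < λ < 1 and let (x, θ) : [s₀, s₁) → (0,∞) × ℝ be a differentiable solution of the system x' = cosh θ, θ' = 2(cosh θ − λ) − sinh θ / x. If θ(s₀) > 0 and 2(cosh θ(s₀) − λ)·x(s₀) > sinh θ(s₀), then for every s ∈ [s₀, s₁): θ(s) > 0, 2(cosh θ(s) − λ)·x(s) > sinh θ(s), and θ'(s) > 0; in particular θ is strictly increasing on [s₀, s₁). -/
open Real Set

open Filter Topology in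
/-- A function on `[a, b)` that starts positive and has positive derivative at each of its zeros
stays positive. -/
theorem pos_of_deriv_pos_of_eq_zero {a b : ℝ} {f f' : ℝ → ℝ}
    (hf : ∀ s ∈ Ico a b, HasDerivWithinAt f (f' s) (Ico a b) s) (ha : 0 < f a)
    (hzero : ∀ s ∈ Ico a b, f s = 0 → 0 < f' s) :
    ∀ s ∈ Ico a b, 0 < f s := by
  intro t ht
  have hsub : Icc a t ⊆ Ico a b := fun u hu => ⟨hu.1, hu.2.trans_lt ht.2⟩
  have hnonneg : ∀ u ∈ Icc a t, 0 ≤ f u := by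
    have hright : ∀ u ∈ Ico a t, HasDerivWithinAt f (f' u) (Ici u) u := fun u hu =>
      (hf u (hsub ⟨hu.1, hu.2.le⟩)).mono_of_mem_nhdsWithin <|
        mem_of_superset (Ico_mem_nhdsGE (hu.2.trans ht.2)) (Ico_subset_Ico_left hu.1)
    exact image_le_of_deriv_right_lt_deriv_boundary' (f := fun _ => 0) (f' := fun _ => 0)
      continuousOn_const (fun u _ => hasDerivWithinAt_const u (Ici u) 0) ha.le
      (fun u hu => ((hf u (hsub hu)).mono hsub).continuousWithinAt) hright
      (fun u hu h => hzero u (hsub ⟨hu.1, hu.2.le⟩) h.symm)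
  refine (hnonneg t ⟨ht.1, le_rfl⟩).lt_of_ne' fun hft => ?_
  have hat : a < t := ht.1.lt_of_ne (by rintro rfl; exact ha.ne' hft)
  have hleft : HasDerivWithinAt f (f' t) (Iio t) t :=
    (hf t ht).mono_of_mem_nhdsWithin <|
      mem_of_superset (Ico_mem_nhdsLT hat) (Ico_subset_Ico_right ht.2.le)
  have hslope := (hasDerivWithinAt_iff_tendsto_slope' self_notMem_Iio).1 hleft
  refine (hzero t ht hft).not_ge (le_of_tendsto hslope ?_)
  filter_upwards [Ico_mem_nhdsLT hat] with u hu
  rw [slope_def_field, hft, sub_zero]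
  exact div_nonpos_of_nonneg_of_nonpos (hnonneg u ⟨hu.1, hu.2.le⟩) (sub_nonpos.2 hu.2.le)

/-- For `0 < λ < 1`, the region `{θ > 0, 2(cosh θ − λ)x > sinh θ}` is positively invariant
for the phase flow of spacelike rotational λ-translators about a timelike axis, and `θ`
is strictly increasing along orbits inside it. -/
theorem invariant_region_spacelike_timelike_axis
    (lam : ℝ) (h0 : 0 < lam) (h1 : lam < 1)
    (s₀ s₁ : ℝ) (x θ : ℝ → ℝ)
    (hxpos : ∀ s ∈ Ico s₀ s₁, 0 < x s)
    (hx : ∀ s ∈ Ico s₀ s₁, HasDerivWithinAt x (Real.cosh (θ s)) (Ico s₀ s₁) s)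
    (hθ : ∀ s ∈ Ico s₀ s₁,
      HasDerivWithinAt θ (2 * (Real.cosh (θ s) - lam) - Real.sinh (θ s) / x s) (Ico s₀ s₁) s)
    (hs₀ : s₀ ∈ Ico s₀ s₁)
    (hθ0 : 0 < θ s₀)
    (hreg : Real.sinh (θ s₀) < 2 * (Real.cosh (θ s₀) - lam) * x s₀) :
    (∀ s ∈ Ico s₀ s₁,
      0 < θ s ∧
      Real.sinh (θ s) < 2 * (Real.cosh (θ s) - lam) * x s ∧
      0 < 2 * (Real.cosh (θ s) - lam) - Real.sinh (θ s) / x s) ∧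
    StrictMonoOn θ (Ico s₀ s₁) := by
  have hF : ∀ s ∈ Ico s₀ s₁,
      0 < 2 * (Real.cosh (θ s) - lam) * x s - Real.sinh (θ s) := by
    refine pos_of_deriv_pos_of_eq_zero
      (fun s hs => ((((hθ s hs).cosh.sub_const lam).const_mul 2).mul (hx s hs)).sub (hθ s hs).sinh)
      (sub_pos.2 hreg) fun s hs hzero => ?_
    have hθ' : 2 * (Real.cosh (θ s) - lam) - Real.sinh (θ s) / x s = 0 := by
      rw [sub_eq_zero, eq_div_iff (hxpos s hs).ne']
      exact sub_eq_zero.1 hzero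
    have hcosh := Real.one_le_cosh (θ s)
    have hpos : 0 < 2 * (Real.cosh (θ s) - lam) * Real.cosh (θ s) :=
      mul_pos (by linarith) (by linarith)
    simpa [hθ'] using hpos
  have hθ' : ∀ s ∈ Ico s₀ s₁, 0 < 2 * (Real.cosh (θ s) - lam) - Real.sinh (θ s) / x s :=
    fun s hs => sub_pos.2 ((div_lt_iff₀ (hxpos s hs)).2 (sub_pos.1 (hF s hs)))
  have hmono : StrictMonoOn θ (Ico s₀ s₁) :=
    strictMonoOn_of_hasDerivWithinAt_pos (convex_Ico s₀ s₁)
      (fun s hs => (hθ s hs).continuousWithinAt)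
      (fun s hs => (hθ s (interior_subset hs)).mono interior_subset)
      (fun s hs => hθ' s (interior_subset hs))
  exact ⟨fun s hs => ⟨hθ0.trans_le (hmono.monotoneOn hs₀ hs hs.1), sub_pos.1 (hF s hs), hθ' s hs⟩,
    hmono⟩
end
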